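/- Every real symmetric positive semidefinite Toeplitz matrix T of rank r ≤ n−1 (size n×n) admits a decomposition T = Σ_{s=1}^{r} w_s v(t_s) v(t_s)*, where w_s > 0, t_s ∈ [0, 2π) are distinct, and v(t) = (1, e^{it}, e^{i2t}, …, e^{i(n−1)t})ᵀ ∈ ℂⁿ. -/

import Mathlib

open scoped Matrix

/-- The rank of a square matrix is invariant under extension of the base field. -/
theorem Matrix.rank_map_of_field {K L m : Type*} [Field K] [Field L] [Fintype m]
    (f : K →+* L) (A : Matrix m m K) : (A.map f).rank = A.rank := by
  classical
  obtain ⟨V, U, e, hV, hU, h⟩ := A.exists_rank_normal_form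
  set d : m → K := fun i => Sum.elim 1 0 (e i) with hd
  have hdiag : V * A * U = Matrix.diagonal d := by
    rw [h, ← Matrix.diagonal_one, ← Matrix.diagonal_zero, Matrix.fromBlocks_diagonal]
    ext i j
    by_cases hij : i = j <;> simp [hij, hd]
    rfl
  have hmap : V.map f * A.map f * U.map f = Matrix.diagonal (f ∘ d) := by
    rw [← Matrix.map_mul, ← Matrix.map_mul, hdiag, Matrix.diagonal_map (map_zero f)]
    rfl
  have hV' : IsUnit (V.map f).det := by
    have := ((Matrix.isUnit_iff_isUnit_det V).1 hV).map f
    rwa [RingHom.map_det] at this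
  have hU' : IsUnit (U.map f).det := by
    have := ((Matrix.isUnit_iff_isUnit_det U).1 hU).map f
    rwa [RingHom.map_det] at this
  rw [← Matrix.rank_mul_eq_right_of_isUnit_det _ (A.map f) hV',
    ← Matrix.rank_mul_eq_left_of_isUnit_det _ (V.map f * A.map f) hU', hmap,
    ← Matrix.rank_mul_eq_right_of_isUnit_det _ A ((Matrix.isUnit_iff_isUnit_det V).1 hV),
    ← Matrix.rank_mul_eq_left_of_isUnit_det _ (V * A) ((Matrix.isUnit_iff_isUnit_det U).1 hU),
    hdiag, Matrix.rank_diagonal, Matrix.rank_diagonal]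
  simp

section Isometry

variable {E : Type*} [NormedAddCommGroup E] [InnerProductSpace ℂ E]

/-- Eigenvalues of a linear isometry have modulus one. -/
theorem LinearIsometry.norm_eigenvalue_eq_one (U : E →ₗᵢ[ℂ] E) {z : ℂ} {v : E} (hv : v ≠ 0)
    (h : U v = z • v) : ‖z‖ = 1 := by
  have := U.norm_map v
  rw [h, norm_smul] at this
  exact mul_right_cancel₀ (norm_ne_zero_iff.2 hv) (this.trans (one_mul _).symm)

/-- Eigenvectors of a linear isometry for different eigenvalues are orthogonal. -/
theorem LinearIsometry.inner_eq_zero_of_eigenvalue_ne (U : E →ₗᵢ[ℂ] E) {z z' : ℂ} {v v' : E}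
    (h : U v = z • v) (h' : U v' = z' • v') (hz : z ≠ z') : inner ℂ v v' = 0 := by
  by_cases hv : v = 0
  · simp [hv]
  have h1 := U.norm_eigenvalue_eq_one hv h
  have hzz : z * (starRingEnd ℂ) z = 1 := by rw [Complex.mul_conj']; simp [h1]
  have hi := U.inner_map_map v v'
  rw [h, h', inner_smul_left, inner_smul_right] at hi
  have : (z' - z) * inner ℂ v v' = 0 := by
    linear_combination z * hi - z' * inner ℂ v v' * hzz
  exact (mul_eq_zero.1 this).resolve_left (sub_ne_zero.2 hz.symm)

variable [FiniteDimensional ℂ E]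

/-- Two families of vectors with the same Gram matrix differ by a linear isometry. -/
theorem exists_linearIsometry_of_inner_eq {ι : Type*} (f g : ι → E)
    (h : ∀ i j, inner ℂ (f i) (f j) = inner ℂ (g i) (g j)) :
    ∃ U : E →ₗᵢ[ℂ] E, ∀ i, U (f i) = g i := by
  set F := Finsupp.linearCombination ℂ f
  set G := Finsupp.linearCombination ℂ g
  have hnorm : ∀ c, ‖F c‖ = ‖G c‖ := by
    intro c
    have hinner : inner ℂ (F c) (F c) = inner ℂ (G c) (G c) := by
      simp only [F, G, Finsupp.linearCombination_apply, Finsupp.sum, sum_inner, inner_sum,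
        inner_smul_left, inner_smul_right, h]
    rw [@norm_eq_sqrt_re_inner ℂ, @norm_eq_sqrt_re_inner ℂ, hinner]
  obtain ⟨R, hR⟩ := F.rangeRestrict.exists_rightInverse_of_surjective F.range_rangeRestrict
  have hFR : ∀ y : LinearMap.range F, F (R y) = y := fun y =>
    congrArg Subtype.val (LinearMap.congr_fun hR y)
  let L : LinearMap.range F →ₗᵢ[ℂ] E :=
    { toLinearMap := G ∘ₗ R
      norm_map' := fun y => by
        rw [LinearMap.comp_apply, ← hnorm, hFR, Submodule.coe_norm] }
  refine ⟨L.extend, fun i => ?_⟩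
  have hFi : F (Finsupp.single i 1) = f i := by simp [F]
  have hGi : G (Finsupp.single i 1) = g i := by simp [G]
  let y : LinearMap.range F := ⟨f i, _, hFi⟩
  have hL : L.extend (f i) = G (R y) := L.extend_apply y
  rw [hL, ← sub_eq_zero, ← hGi, ← map_sub, ← norm_eq_zero, ← hnorm, map_sub, hFR, hFi]
  simp [y]

/-- A linear isometry of a finite-dimensional complex inner product space is diagonalizable. -/
theorem LinearIsometry.iSup_eigenspace_eq_top (U : E →ₗᵢ[ℂ] E) :
    ⨆ z, Module.End.eigenspace U.toLinearMap z = ⊤ := by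
  set S := ⨆ z, Module.End.eigenspace U.toLinearMap z with hS
  have hinv : ∀ w ∈ Sᗮ, U.toLinearMap w ∈ Sᗮ := by
    intro w hw
    rw [hS, ← Submodule.iInf_orthogonal, Submodule.mem_iInf] at hw ⊢
    intro z v hv
    by_cases hv0 : v = 0
    · simp [hv0]
    have hUv : U v = z • v := Module.End.mem_eigenspace_iff.1 hv
    have hz : z ≠ 0 := norm_ne_zero_iff.1 (by simp [U.norm_eigenvalue_eq_one hv0 hUv])
    have h0 := U.inner_map_map v w
    rw [hw z v hv, hUv, inner_smul_left] at h0
    exact (mul_eq_zero.1 h0).resolve_left (by simpa using hz)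
  rw [← Submodule.orthogonal_eq_bot_iff]
  by_contra hne
  have : Nontrivial Sᗮ := Submodule.nontrivial_iff_ne_bot.2 hne
  obtain ⟨z, hz⟩ := Module.End.exists_eigenvalue (U.toLinearMap.restrict hinv)
  obtain ⟨v, hv⟩ := hz.exists_hasEigenvector
  have hvS : (v : E) ∈ S := by
    refine Submodule.mem_iSup_of_mem z (Module.End.mem_eigenspace_iff.2 ?_)
    exact congrArg Subtype.val hv.apply_eq_smul
  have : inner ℂ (v : E) (v : E) = 0 := v.2 _ hvS
  exact hv.2 (Subtype.ext (inner_self_eq_zero.1 this))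

/-- The shift-invariant Gram matrix of a spanning finite sequence of vectors is a positive
combination of as many rank-one Vandermonde terms, with distinct nodes on the unit circle, as the
dimension of the space. -/
theorem exists_inner_eq_sum_vandermonde {m : ℕ} (x : Fin (m + 1) → E)
    (hspan : Submodule.span ℂ (Set.range x) = ⊤)
    (hx : ∀ i j : Fin m, inner ℂ (x i.castSucc) (x j.castSucc) = inner ℂ (x i.succ) (x j.succ)) :
    ∃ (w : Fin (Module.finrank ℂ E) → ℝ) (z : Fin (Module.finrank ℂ E) → ℂ),
      (∀ s, 0 < w s) ∧ (∀ s, ‖z s‖ = 1) ∧ Function.Injective z ∧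
      ∀ k j, inner ℂ (x j) (x k) =
        ∑ s, (w s : ℂ) * z s ^ (k : ℕ) * (starRingEnd ℂ) (z s ^ (j : ℕ)) := by
  obtain ⟨U, hU⟩ := exists_linearIsometry_of_inner_eq _ _ hx
  have hmem : x 0 ∈ ⨆ z, Module.End.eigenspace U.toLinearMap z :=
    U.iSup_eigenspace_eq_top ▸ Submodule.mem_top
  obtain ⟨f, hf, hsum⟩ := (Submodule.mem_iSup_iff_exists_finsupp _ _).1 hmem
  have hUf : ∀ z, U (f z) = z • f z := fun z => Module.End.mem_eigenspace_iff.1 (hf z)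
  have hne : ∀ z : f.support, f z ≠ 0 := fun z => Finsupp.mem_support_iff.1 z.2
  have hxk : ∀ k, x k = ∑ z : f.support, (z : ℂ) ^ (k : ℕ) • f z := by
    intro k
    induction k using Fin.induction with
    | zero =>
      rw [← hsum, Finsupp.sum, ← Finset.sum_coe_sort]
      simp
    | succ i ih =>
      rw [← hU, ih, map_sum]
      refine Finset.sum_congr rfl fun z _ => ?_
      rw [map_smul, hUf, smul_smul, Fin.val_succ, pow_succ, Fin.val_castSucc]
  have hli : LinearIndependent ℂ (fun z : f.support => f z) :=
    Module.End.eigenvectors_linearIndependent' U.toLinearMap _ Subtype.val_injective _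
      fun z => ⟨hf z, hne z⟩
  have htop : Submodule.span ℂ (Set.range fun z : f.support => f z) = ⊤ := by
    rw [eq_top_iff, ← hspan, Submodule.span_le]
    rintro _ ⟨k, rfl⟩
    rw [hxk]
    exact Submodule.sum_mem _ fun z _ =>
      Submodule.smul_mem _ _ (Submodule.subset_span ⟨z, rfl⟩)
  have hcard : Fintype.card f.support = Module.finrank ℂ E := by
    rw [← finrank_span_eq_card hli, htop, finrank_top]
  let e := (Fintype.equivFinOfCardEq hcard).symm
  refine ⟨fun s => ‖f (e s)‖ ^ 2, fun s => e s,
    fun s => pow_pos (norm_pos_iff.2 (hne _)) 2,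
    fun s => U.norm_eigenvalue_eq_one (hne _) (hUf _),
    Subtype.val_injective.comp e.injective, fun k j => ?_⟩
  rw [e.sum_comp fun z : f.support => ((‖f z‖ ^ 2 : ℝ) : ℂ) * (z : ℂ) ^ (k : ℕ) *
    (starRingEnd ℂ) ((z : ℂ) ^ (j : ℕ)), hxk, hxk, sum_inner]
  refine Finset.sum_congr rfl fun z _ => ?_
  rw [inner_sum, Finset.sum_eq_single z]
  · rw [inner_smul_left, inner_smul_right, inner_self_eq_norm_sq_to_K]
    push_cast
    simp only [Complex.coe_algebraMap]
    ring
  · intro z' _ hz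
    rw [inner_smul_left, inner_smul_right, U.inner_eq_zero_of_eigenvalue_ne (hUf _) (hUf _)
      fun h => hz (Subtype.ext h.symm)]
    simp
  · simp

end Isometry

/-- Every point of the unit circle has an argument in `[0, 2π)`. -/
theorem Complex.exists_mem_Ico_exp_eq {z : ℂ} (hz : ‖z‖ = 1) :
    ∃ t ∈ Set.Ico 0 (2 * Real.pi), Complex.exp (t * Complex.I) = z := by
  obtain ⟨θ, rfl⟩ := (Complex.norm_eq_one_iff z).1 hz
  refine ⟨toIcoMod Real.two_pi_pos 0 θ, toIcoMod_mem_Ico' _ _, ?_⟩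
  rw [toIcoMod, Complex.exp_eq_exp_iff_exists_int]
  refine ⟨-toIcoDiv Real.two_pi_pos 0 θ, ?_⟩
  push_cast [zsmul_eq_mul]
  ring

open scoped ComplexOrder in
/-- A real positive semidefinite matrix of rank `r` is the Gram matrix of a spanning family in
a complex inner product space of dimension `r`. -/
theorem Matrix.PosSemidef.exists_complex_gram {n : Type*} [Fintype n] {T : Matrix n n ℝ}
    (hT : T.PosSemidef) :
    ∃ (d : ℕ) (H : Submodule ℂ (EuclideanSpace ℂ (Fin d))) (x : n → H),
      Module.finrank ℂ H = T.rank ∧ Submodule.span ℂ (Set.range x) = ⊤ ∧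
      ∀ k j, inner ℂ (x k) (x j) = (T k j : ℂ) := by
  obtain ⟨d, v, hv⟩ := Matrix.posSemidef_iff_eq_sum_vecMulVec.1 hT
  let B : Matrix (Fin d) n ℂ := Matrix.of fun i k => (v i k : ℂ)
  have hB : Bᴴ * B = T.map Complex.ofRealHom := by
    ext k j
    simp [hv, B, Matrix.mul_apply, Matrix.sum_apply, Matrix.vecMulVec_apply]
  let y : n → EuclideanSpace ℂ (Fin d) := fun k => WithLp.toLp 2 (B.col k)
  have hy : ∀ k j, inner ℂ (y k) (y j) = (T k j : ℂ) := by
    intro k j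
    have := congrFun (congrFun hB k) j
    simp only [Matrix.mul_apply, Matrix.conjTranspose_apply, Matrix.map_apply] at this
    simp only [PiLp.inner_apply, y, Matrix.col_apply, RCLike.inner_apply]
    rw [← Complex.ofRealHom_eq_coe, ← this]
    exact Finset.sum_congr rfl fun i _ => mul_comm _ _
  have hrank : Module.finrank ℂ (Submodule.span ℂ (Set.range y)) = T.rank := by
    rw [← Matrix.rank_map_of_field Complex.ofRealHom T, ← hB, Matrix.rank_conjTranspose_mul_self,
      Matrix.rank_eq_finrank_span_cols]
    let e := (WithLp.linearEquiv 2 ℂ (Fin d → ℂ)).symm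
    rw [← LinearEquiv.finrank_map_eq e, Submodule.map_span, ← Set.range_comp]
    rfl
  refine ⟨d, Submodule.span ℂ (Set.range y),
    fun k => ⟨y k, Submodule.subset_span ⟨k, rfl⟩⟩, hrank, ?_, fun k j => hy k j⟩
  exact (Submodule.span_range_subtype_eq_top_iff _ _).2 rfl

theorem caratheodory_fejer_decomposition (n r : ℕ) (hr : r ≤ n - 1)
    (T : Matrix (Fin n) (Fin n) ℝ)
    (hpsd : T.PosSemidef)
    (htoep : ∀ k j k' j' : Fin n, (j : ℤ) - (k : ℤ) = (j' : ℤ) - (k' : ℤ) → T k j = T k' j')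
    (hrank : T.rank = r) :
    ∃ (w : Fin r → ℝ) (t : Fin r → ℝ),
      (∀ s, 0 < w s) ∧ (∀ s, t s ∈ Set.Ico 0 (2 * Real.pi)) ∧ Function.Injective t ∧
      ∀ k j : Fin n, (T k j : ℂ) =
        ∑ s : Fin r, (w s : ℂ) * Complex.exp (Complex.I * (k : ℕ) * t s) *
          (starRingEnd ℂ) (Complex.exp (Complex.I * (j : ℕ) * t s)) := by
  obtain _ | m := n
  · obtain rfl : r = 0 := by omega
    exact ⟨0, 0, fun s => s.elim0, fun s => s.elim0, fun s => s.elim0, fun k => k.elim0⟩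
  obtain ⟨d, H, x, hfin, hspan, hx⟩ := hpsd.exists_complex_gram
  rw [hrank] at hfin
  subst hfin
  obtain ⟨w, z, hw, hz, hzinj, hwz⟩ := exists_inner_eq_sum_vandermonde x hspan fun i j => by
    rw [hx, hx, htoep i.castSucc j.castSucc i.succ j.succ (by simp)]
  choose t ht hexp using fun s => Complex.exists_mem_Ico_exp_eq (hz s)
  refine ⟨w, t, hw, ht,
    fun s s' h => hzinj (by rw [← hexp, ← hexp, h]), fun k j => ?_⟩
  have hpow : ∀ (k : ℕ) s, Complex.exp (Complex.I * k * t s) = z s ^ k := by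
    intro k s
    rw [← hexp, ← Complex.exp_nat_mul]
    ring_nf
  have hsymm : T k j = T j k := by simpa using hpsd.isHermitian.apply j k
  rw [hsymm, ← hx, hwz]
  simp only [hpow]
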